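/- (Telescoping step in the sufficiency proof of Proposition 1.) If Q : Y⁻ × W → ℝ satisfies the RAML recursion, then for every y ∈ Y, Π_{t=1}^{|y|} P_Q(y_t | y_1^{t-1}) = exp( (R(y) − R(∅) − V_Q(∅)) / τ ), where ∅ denotes the empty sequence and R(∅) = R(∅ + eos) by the extension of R. -/

import Mathlib

/-- `y ∈ Y`: length at most `T`, ends with `eos`, and no other occurrence of `eos`. -/
def memY {W : Type*} (eos : W) (T : ℕ) (y : List W) : Prop :=
  y.length ≤ T ∧ ∃ s : List W, y = s ++ [eos] ∧ eos ∉ s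

/-- `s ∈ Y⁻`: length at most `T - 1` and no occurrence of `eos`. -/
def memYm {W : Type*} (eos : W) (T : ℕ) (s : List W) : Prop :=
  s.length ≤ T - 1 ∧ eos ∉ s

/-- Soft value function `V_Q(s) = τ log Σ_w exp (Q(s,w)/τ)`. -/
noncomputable def softV {W : Type*} [Fintype W] (τ : ℝ) (Q : List W → W → ℝ) (s : List W) : ℝ :=
  τ * Real.log (∑ w : W, Real.exp (Q s w / τ))

/-- Token-level Boltzmann distribution `P_Q(w | s)`. -/
noncomputable def tokP {W : Type*} [Fintype W] (τ : ℝ) (Q : List W → W → ℝ) (s : List W) (w : W) : ℝ :=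
  Real.exp (Q s w / τ) / ∑ w' : W, Real.exp (Q s w' / τ)

/-- Induced sequence probability `∏_{t=1}^{|y|} P_Q(y_t | y_1^{t-1})`. -/
noncomputable def seqP {W : Type*} [Fintype W] (τ : ℝ) (Q : List W → W → ℝ) (y : List W) : ℝ :=
  ∏ t : Fin y.length, tokP τ Q (y.take t.1) (y.get t)

/-- Exponentiated pay-off distribution `P_R`. -/
noncomputable def PRdist {W : Type*} [Fintype W] (eos : W) (T : ℕ) (τ : ℝ)
    (R : List W → ℝ) (y : List W) : ℝ :=
  Real.exp (R y / τ) / ∑ᶠ y' ∈ {z : List W | memY eos T z}, Real.exp (R y' / τ)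

/-- The marginal match condition. -/
def MarginalMatch {W : Type*} [Fintype W] (eos : W) (T : ℕ) (τ : ℝ) (R : List W → ℝ)
    (Q : List W → W → ℝ) : Prop :=
  ∀ y : List W, memY eos T y → seqP τ Q y = PRdist eos T τ R y

/-- The terminal condition. -/
def Terminal {W : Type*} (eos : W) (T : ℕ) (R : List W → ℝ) (Q : List W → W → ℝ) : Prop :=
  ∀ s : List W, memYm eos T s → Q s eos = R (s ++ [eos]) - R s

/-- The RAML recursion. -/
def RAMLrec {W : Type*} [Fintype W] (eos : W) (T : ℕ) (τ : ℝ) (R : List W → ℝ)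
    (Q : List W → W → ℝ) : Prop :=
  ∀ y : List W, memY eos T y → ∀ t : ℕ, ∀ _h1 : 1 ≤ t, ∀ _h2 : t ≤ y.length,
    (t < y.length →
      Q (y.take (t - 1)) (y.get ⟨t - 1, by omega⟩) =
        R (y.take t) - R (y.take (t - 1)) + softV τ Q (y.take t)) ∧
    (t = y.length →
      Q (y.take (t - 1)) (y.get ⟨t - 1, by omega⟩) =
        R (y.take t) - R (y.take (t - 1)))

/-- The token-level Boltzmann distribution written through the soft value function. -/
theorem tokP_eq_exp {W : Type*} [Fintype W] {τ : ℝ} (hτ : 0 < τ) (Q : List W → W → ℝ)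
    (s : List W) (w : W) : tokP τ Q s w = Real.exp ((Q s w - softV τ Q s) / τ) := by
  have hpos : 0 < ∑ w' : W, Real.exp (Q s w' / τ) :=
    Finset.sum_pos (fun _ _ => Real.exp_pos _) ⟨w, Finset.mem_univ w⟩
  rw [tokP, softV, sub_div, mul_div_cancel_left₀ _ hτ.ne', Real.exp_sub, Real.exp_log hpos]

/-- Telescoping step of the sufficiency proof of Proposition 1:
`∏ P_Q(y_t | y_1^{t-1}) = exp ((R(y) - R(∅) - V_Q(∅)) / τ)` for every `y ∈ Y`. -/
theorem stmt3 {W : Type*} [Fintype W] (eos : W) (T : ℕ) (hT : 1 ≤ T)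
    (τ : ℝ) (hτ : 0 < τ) (R : List W → ℝ)
    (hext : ∀ s : List W, memYm eos T s → R s = R (s ++ [eos]))
    (Q : List W → W → ℝ)
    (hrec : RAMLrec eos T τ R Q) :
    ∀ y : List W, memY eos T y →
      seqP τ Q y =
        Real.exp ((R y - R ([] : List W) - softV τ Q ([] : List W)) / τ) := by
  intro y hy
  have hlen : 0 < y.length := by
    obtain ⟨_, s, rfl, _⟩ := hy
    simp
  let f : ℕ → ℝ := fun t => R (y.take t) + if t < y.length then softV τ Q (y.take t) else 0
  have hstep (t : Fin y.length) :
      tokP τ Q (y.take t.1) (y.get t) = Real.exp ((f (t.1 + 1) - f t.1) / τ) := by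
    rw [tokP_eq_exp hτ]
    congr 2
    obtain ⟨hlt, heq⟩ := hrec y hy (t.1 + 1) (by omega) t.2
    simp only [Nat.add_sub_cancel, Fin.eta] at hlt heq
    rcases (Nat.succ_le_of_lt t.2).lt_or_eq with h | h
    · simp only [f, if_pos h, if_pos t.2, hlt h]
      ring
    · simp only [f, if_neg (Nat.not_lt.mpr h.ge), if_pos t.2, heq h]
      ring
  rw [seqP, Finset.prod_congr rfl fun t _ => hstep t, ← Real.exp_sum, ← Finset.sum_div,
    Fin.sum_univ_eq_sum_range (fun t => f (t + 1) - f t), Finset.sum_range_sub]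
  congr 2
  simp only [f, lt_irrefl, if_false, if_pos hlen, List.take_length, List.take_zero]
  ring
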